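/- Two-dimensional embedding lemma (used in the proof of Lemma 2.1): let 0 < c < C, and in ℝ² let P₁ = [0,1] × [0, C−c], L = [1,2] × {0}, P₂ = [2,3] × [0,c], and Y = P₁ ∪ L ∪ P₂. Then for every open neighbourhood U of Y and every open neighbourhood U₁ of P₁ there exists an area-preserving (symplectic) embedding g : B²(C) → U which maps some open neighbourhood (in B²(C)) of the set B²(C−c) ∪ ({(u,0) : u < 0} ∩ B²(C)) into U₁. -/

import Mathlib

open Real Set

noncomputable section

/-- The standard area form on `ℝ²`. -/
def omega2 (v w : ℝ × ℝ) : ℝ := v.1 * w.2 - v.2 * w.1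

/-- The open disc `B²(a) ⊆ ℝ²` centred at `0` of area `a`, i.e. of radius `√(a/π)`. -/
def disc (a : ℝ) : Set (ℝ × ℝ) := {z | z.1 ^ 2 + z.2 ^ 2 < a / π}

/-- `f` is an area-preserving (symplectic) embedding on the set `s ⊆ ℝ²`. -/
def SympEmb2 (f : ℝ × ℝ → ℝ × ℝ) (s : Set (ℝ × ℝ)) : Prop :=
  ContDiffOn ℝ (⊤ : ℕ∞) f s ∧ Set.InjOn f s ∧
    ∀ p ∈ s, ∀ v w, omega2 (fderiv ℝ f p v) (fderiv ℝ f p w) = omega2 v w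


theorem SympEmb2.comp {f g : ℝ × ℝ → ℝ × ℝ} {s t : Set (ℝ × ℝ)} (hs : IsOpen s) (ht : IsOpen t)
    (hg : SympEmb2 g t) (hf : SympEmb2 f s) (h : MapsTo f s t) : SympEmb2 (g ∘ f) s := by
  refine ⟨hg.1.comp hf.1 h, hg.2.1.comp hf.2.1 h, fun p hp v w => ?_⟩
  have hfd : DifferentiableAt ℝ f p :=
    (hf.1.contDiffAt (hs.mem_nhds hp)).differentiableAt (by simp)
  have hgd : DifferentiableAt ℝ g (f p) :=
    (hg.1.contDiffAt (ht.mem_nhds (h hp))).differentiableAt (by simp)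
  rw [fderiv_comp p hgd hfd]
  simp only [ContinuousLinearMap.comp_apply]
  rw [hg.2.2 _ (h hp), hf.2.2 _ hp]

theorem contDiffOn_of_hasDerivAt {α α' : ℝ → ℝ} {I : Set ℝ} (hI : IsOpen I)
    (hα : ∀ x ∈ I, HasDerivAt α (α' x) x) (hα' : ContDiffOn ℝ (⊤ : ℕ∞) α' I) :
    ContDiffOn ℝ (⊤ : ℕ∞) α I := by
  refine (contDiffOn_infty_iff_deriv_of_isOpen hI).2
    ⟨fun x hx => (hα x hx).differentiableAt.differentiableWithinAt, ?_⟩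
  exact hα'.congr fun x hx => (hα x hx).deriv

/-- Reparametrizing the first coordinate and rescaling the fibres accordingly is symplectic. -/
theorem sympEmb2_of_fst {α α' γ : ℝ → ℝ} {I : Set ℝ} (hI : IsOpen I)
    (hα : ∀ x ∈ I, HasDerivAt α (α' x) x) (hα' : ContDiffOn ℝ (⊤ : ℕ∞) α' I)
    (hpos : ∀ x ∈ I, 0 < α' x) (hinj : InjOn α I) (hγ : ContDiffOn ℝ (⊤ : ℕ∞) γ I) :
    SympEmb2 (fun p => (α p.1, (p.2 + γ p.1) / α' p.1)) (I ×ˢ univ) := by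
  have hαs := contDiffOn_of_hasDerivAt hI hα hα'
  have hfst : MapsTo (Prod.fst : ℝ × ℝ → ℝ) (I ×ˢ univ) I := fun p hp => hp.1
  have hsm : ContDiffOn ℝ (⊤ : ℕ∞) (fun p : ℝ × ℝ => (p.2 + γ p.1) / α' p.1) (I ×ˢ univ) :=
    (contDiffOn_snd.add (hγ.comp contDiffOn_fst hfst)).div (hα'.comp contDiffOn_fst hfst)
      fun p hp => (hpos _ hp.1).ne'
  refine ⟨(hαs.comp contDiffOn_fst hfst).prodMk hsm, ?_, ?_⟩
  · rintro ⟨x, y⟩ hp ⟨x', y'⟩ hq h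
    simp only [Prod.mk.injEq] at h
    obtain rfl := hinj hp.1 hq.1 h.1
    have := (div_left_inj' (hpos _ hp.1).ne').1 h.2
    simp_all
  · rintro ⟨x, y⟩ hp v w
    have hx : x ∈ I := hp.1
    have hd (g : ℝ → ℝ) (hg : ContDiffOn ℝ (⊤ : ℕ∞) g I) : HasDerivAt g (deriv g x) x :=
      ((hg.contDiffAt (hI.mem_nhds hx)).differentiableAt (by simp)).hasDerivAt
    have hβ : HasDerivAt (fun x => (α' x)⁻¹) (-deriv α' x / α' x ^ 2) x :=
      (hd _ hα').inv (hpos _ hx).ne'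
    have h1 : HasFDerivAt (Prod.fst : ℝ × ℝ → ℝ) (ContinuousLinearMap.fst ℝ ℝ ℝ) (x, y) :=
      hasFDerivAt_fst
    have h2 : HasFDerivAt (Prod.snd : ℝ × ℝ → ℝ) (ContinuousLinearMap.snd ℝ ℝ ℝ) (x, y) :=
      hasFDerivAt_snd
    have ha := (hα x hx).comp_hasFDerivAt (x, y) h1
    have hb := hβ.comp_hasFDerivAt (x, y) h1
    have hc := (hd _ hγ).comp_hasFDerivAt (x, y) h1
    have hf := ha.prodMk ((h2.add hc).mul hb)
    have hf' : HasFDerivAt (fun p : ℝ × ℝ => (α p.1, (p.2 + γ p.1) / α' p.1)) _ (x, y) :=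
      hf.congr_of_eventuallyEq (.of_forall fun p => by simp [div_eq_mul_inv])
    rw [hf'.fderiv]
    have := (hpos _ hx).ne'
    simp [omega2]
    field_simp
    ring

/-- Reparametrizing the second coordinate and rescaling the fibres accordingly is symplectic. -/
theorem sympEmb2_of_snd {α α' : ℝ → ℝ}
    (hα : ∀ x, HasDerivAt α (α' x) x) (hα' : ContDiff ℝ (⊤ : ℕ∞) α')
    (hpos : ∀ x, 0 < α' x) (hinj : Function.Injective α) :
    SympEmb2 (fun p => (p.1 / α' p.2, α p.2)) univ := by
  have hS := sympEmb2_of_fst (γ := fun _ => 0) isOpen_univ (fun x _ => hα x) hα'.contDiffOn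
    (fun x _ => hpos x) hinj.injOn contDiffOn_const
  simp only [univ_prod_univ, add_zero] at hS
  have hswap : ContDiff ℝ (⊤ : ℕ∞) (Prod.swap : ℝ × ℝ → ℝ × ℝ) := contDiff_snd.prodMk contDiff_fst
  have hsw (p : ℝ × ℝ) : HasFDerivAt (Prod.swap : ℝ × ℝ → ℝ × ℝ)
      ((ContinuousLinearMap.snd ℝ ℝ ℝ).prod (ContinuousLinearMap.fst ℝ ℝ ℝ)) p :=
    hasFDerivAt_snd.prodMk hasFDerivAt_fst
  set S : ℝ × ℝ → ℝ × ℝ := fun p => (α p.1, p.2 / α' p.1)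
  have he : (fun p : ℝ × ℝ => (p.1 / α' p.2, α p.2)) = Prod.swap ∘ S ∘ Prod.swap := rfl
  rw [he]
  refine ⟨hswap.comp_contDiffOn (hS.1.comp hswap.contDiffOn (mapsTo_univ _ _)), ?_, ?_⟩
  · exact (Prod.swap_injective.comp ((injOn_univ.1 hS.2.1).comp Prod.swap_injective)).injOn
  · intro p _ v w
    have hSd : HasFDerivAt S (fderiv ℝ S p.swap) p.swap :=
      ((contDiffOn_univ.1 hS.1).differentiable (by simp) _).hasFDerivAt
    have hom := hS.2.2 p.swap (mem_univ _) v.swap w.swap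
    rw [((hsw _).comp p (hSd.comp p (hsw p))).fderiv]
    simp only [omega2, Prod.fst_swap, Prod.snd_swap] at hom ⊢
    simp only [ContinuousLinearMap.comp_apply, ContinuousLinearMap.prod_apply,
      ContinuousLinearMap.coe_fst', ContinuousLinearMap.coe_snd']
    change (fderiv ℝ S p.swap v.swap).2 * (fderiv ℝ S p.swap w.swap).1 -
      (fderiv ℝ S p.swap v.swap).1 * (fderiv ℝ S p.swap w.swap).2 = _
    linarith

theorem hasDerivAt_integral_of_continuous {f : ℝ → ℝ} (hf : Continuous f) (a x : ℝ) :
    HasDerivAt (fun u => ∫ t in a..u, f t) (f x) x :=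
  intervalIntegral.integral_hasDerivAt_right (hf.intervalIntegrable _ _)
    (hf.stronglyMeasurableAtFilter _ _) hf.continuousAt

/-- The primitive of a positive smooth function bounded below has a smooth inverse. -/
theorem exists_smooth_inverse_primitive {h : ℝ → ℝ} (hh : ContDiff ℝ (⊤ : ℕ∞) h) {m : ℝ}
    (hm : 0 < m) (hmh : ∀ x, m ≤ h x) :
    ∃ ψ : ℝ → ℝ, ContDiff ℝ (⊤ : ℕ∞) ψ ∧ StrictMono ψ ∧ (∀ y, HasDerivAt ψ (h (ψ y))⁻¹ y) ∧
      ∀ x, ψ (∫ t in (0 : ℝ)..x, h t) = x := by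
  set H : ℝ → ℝ := fun x => ∫ t in (0 : ℝ)..x, h t
  have hd (x : ℝ) : HasDerivAt H (h x) x := hasDerivAt_integral_of_continuous hh.continuous 0 x
  have hpos (x : ℝ) : 0 < h x := hm.trans_le (hmh x)
  have hmono : StrictMono H := strictMono_of_hasDerivAt_pos hd hpos
  have hHc : Continuous H := continuous_iff_continuousAt.2 fun x => (hd x).continuousAt
  have hlin : Monotone fun x => H x - m * x := by
    refine monotone_of_hasDerivAt_nonneg (f' := fun x => h x - m * 1)
      (fun x => (hd x).sub ((hasDerivAt_id x).const_mul m)) fun x => ?_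
    simpa using hmh x
  have hH0 : H 0 = 0 := by simp [H]
  have hsurj : Function.Surjective H := by
    refine hHc.surjective ?_ ?_
    · refine Filter.tendsto_atTop_mono' _ ?_ (Filter.tendsto_id.const_mul_atTop hm)
      filter_upwards [Filter.eventually_ge_atTop 0] with x hx
      have := hlin hx
      simp only [hH0] at this
      simp only [id]; linarith
    · refine Filter.tendsto_atBot_mono' _ ?_ (Filter.tendsto_id.const_mul_atBot hm)
      filter_upwards [Filter.eventually_le_atBot 0] with x hx
      have := hlin hx
      simp only [hH0] at this
      simp only [id]; linarith
  let e := (hmono.orderIsoOfSurjective H hsurj).toHomeomorph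
  have hes (x : ℝ) : e.symm (H x) = x := e.symm_apply_apply x
  have hsm : ContDiff ℝ (⊤ : ℕ∞) H :=
    contDiffOn_univ.1 (contDiffOn_of_hasDerivAt isOpen_univ (fun x _ => hd x) hh.contDiffOn)
  refine ⟨e.symm, e.contDiff_symm_deriv (f' := h) (fun x => (hpos x).ne') hd hsm, ?_, ?_, hes⟩
  · exact (hmono.orderIsoOfSurjective H hsurj).symm.strictMono
  · intro y
    exact (hd _).of_local_left_inverse e.symm.continuous.continuousAt (hpos _).ne'
      (Filter.Eventually.of_forall fun z => e.apply_symm_apply z)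

theorem exists_smooth_between {f : ℝ → ℝ} (hf : Continuous f) {ε : ℝ} (hε : 0 < ε) :
    ∃ g : ℝ → ℝ, ContDiff ℝ (⊤ : ℕ∞) g ∧ ∀ x, f x < g x ∧ g x < f x + ε := by
  obtain ⟨g, hg, hfg, -⟩ := (hf.add_const (ε / 2)).exists_contDiff_approx (⊤ : ℕ∞)
    (ε := fun _ => ε / 2) continuous_const (fun _ => half_pos hε)
  refine ⟨g, hg, fun x => ?_⟩
  have := hfg x
  rw [Real.dist_eq, abs_lt] at this
  constructor <;> linarith [this.1, this.2]

theorem exists_disc_profile {r R ε : ℝ} (hr : 0 < r) (hrR : r < R) (hε : 0 < ε) :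
    ∃ κ : ℝ → ℝ, ∃ δ > 0, ContDiff ℝ (⊤ : ℕ∞) κ ∧ (∀ u, δ ≤ κ u) ∧ (∀ u, κ u ≤ 1) ∧
      (∀ u, √(r ^ 2 - u ^ 2) ≤ κ u * √(R ^ 2 - u ^ 2)) ∧
      ∀ u, κ u * √(R ^ 2 - u ^ 2) ≤ √(r ^ 2 - u ^ 2) + ε := by
  have hR : 0 < R := hr.trans hrR
  have hrR2 : 0 < R ^ 2 - r ^ 2 := by nlinarith
  have hden (u : ℝ) : 0 < max √(R ^ 2 - u ^ 2) √(R ^ 2 - r ^ 2) :=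
    lt_max_of_lt_right (Real.sqrt_pos.2 hrR2)
  set K : ℝ → ℝ := fun u => √(r ^ 2 - u ^ 2) / max √(R ^ 2 - u ^ 2) √(R ^ 2 - r ^ 2) with hK
  have hKc : Continuous K := by
    refine Continuous.div (by fun_prop) (by fun_prop) fun u => (hden u).ne'
  have hK0 (u : ℝ) : 0 ≤ K u := by positivity
  have hKw (u : ℝ) : K u * √(R ^ 2 - u ^ 2) = √(r ^ 2 - u ^ 2) := by
    rcases le_total (u ^ 2) (r ^ 2) with h | h
    · have h1 : √(R ^ 2 - r ^ 2) ≤ √(R ^ 2 - u ^ 2) := Real.sqrt_le_sqrt (by linarith)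
      have h2 : √(R ^ 2 - u ^ 2) ≠ 0 := (Real.sqrt_pos.2 (by linarith)).ne'
      simp only [hK, max_eq_left h1]
      field_simp
    · have : √(r ^ 2 - u ^ 2) = 0 := Real.sqrt_eq_zero_of_nonpos (by linarith)
      simp [hK, this]
  have hKle (u : ℝ) : K u ≤ r / R := by
    rw [div_le_div_iff₀ (hden u) hR]
    refine le_trans ?_ (mul_le_mul_of_nonneg_left (le_max_left _ _) hr.le)
    rcases le_total (u ^ 2) (r ^ 2) with h | h
    · refine abs_le_of_sq_le_sq' ?_ (by positivity) |>.2
      rw [mul_pow, mul_pow, Real.sq_sqrt (by linarith), Real.sq_sqrt (by linarith)]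
      nlinarith [sq_nonneg u]
    · rw [Real.sqrt_eq_zero_of_nonpos (by linarith)]
      simp; positivity
  set δ := min ((1 - r / R) / 2) (ε / (2 * R)) with hδ
  have hlt : r / R < 1 := (div_lt_one hR).2 hrR
  have hδ0 : 0 < δ := lt_min (by linarith) (by positivity)
  have hδ1 : δ ≤ (1 - r / R) / 2 := min_le_left _ _
  have hδ2 : 2 * δ * R ≤ ε := by
    have : δ ≤ ε / (2 * R) := min_le_right _ _
    rw [le_div_iff₀ (by positivity)] at this
    linarith
  obtain ⟨κ, hκ, hκb⟩ := exists_smooth_between (hKc.add_const δ) hδ0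
  refine ⟨κ, δ, hδ0, hκ, fun u => ?_, fun u => ?_, fun u => ?_, fun u => ?_⟩
  · linarith [hK0 u, (hκb u).1]
  · linarith [hKle u, (hκb u).2]
  · rw [← hKw u]
    exact mul_le_mul_of_nonneg_right (by linarith [(hκb u).1]) (Real.sqrt_nonneg _)
  · have hw : √(R ^ 2 - u ^ 2) ≤ R := by
      rw [Real.sqrt_le_left hR.le]; nlinarith [sq_nonneg u]
    have : κ u * √(R ^ 2 - u ^ 2) ≤ (K u + 2 * δ) * √(R ^ 2 - u ^ 2) :=
      mul_le_mul_of_nonneg_right (by linarith [(hκb u).2]) (Real.sqrt_nonneg _)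
    have h2 : 2 * δ * √(R ^ 2 - u ^ 2) ≤ 2 * δ * R := mul_le_mul_of_nonneg_left hw (by linarith)
    rw [add_mul, hKw u] at this
    linarith

theorem integral_sqrt_sq_sub_sq {R : ℝ} (hR : 0 < R) :
    ∫ u in (-R)..R, √(R ^ 2 - u ^ 2) = π * R ^ 2 / 2 := by
  have h := intervalIntegral.integral_comp_div (a := -R) (b := R)
    (fun x => √(1 - x ^ 2)) hR.ne'
  have h1 : -R / R = -1 := by field_simp
  rw [h1, div_self hR.ne', integral_sqrt_one_sub_sq] at h
  have h2 (u : ℝ) : √(R ^ 2 - u ^ 2) = R * √(1 - (u / R) ^ 2) := by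
    have : R ^ 2 - u ^ 2 = R ^ 2 * (1 - (u / R) ^ 2) := by field_simp
    rw [this, Real.sqrt_mul (by positivity), Real.sqrt_sq hR.le]
  simp_rw [h2]
  rw [intervalIntegral.integral_const_mul, h, smul_eq_mul]
  ring

theorem integral_sqrt_sq_sub_sq_of_le {r R : ℝ} (hr : 0 < r) (hrR : r ≤ R) :
    ∫ u in (-R)..R, √(r ^ 2 - u ^ 2) = π * r ^ 2 / 2 := by
  have hc : Continuous fun u : ℝ => √(r ^ 2 - u ^ 2) := by fun_prop
  have hi (a b : ℝ) := hc.intervalIntegrable (μ := MeasureTheory.volume) a b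
  have h0 {a b : ℝ} (hab : a ≤ b) (h : ∀ u ∈ Icc a b, r ^ 2 ≤ u ^ 2) :
      ∫ u in a..b, √(r ^ 2 - u ^ 2) = 0 := by
    rw [intervalIntegral.integral_congr (g := fun _ => 0), intervalIntegral.integral_zero]
    intro u hu
    rw [uIcc_of_le hab] at hu
    exact Real.sqrt_eq_zero_of_nonpos (by linarith [h u hu])
  rw [← intervalIntegral.integral_add_adjacent_intervals (hi (-R) (-r)) (hi (-r) R),
    ← intervalIntegral.integral_add_adjacent_intervals (hi (-r) r) (hi r R),
    h0 (by linarith) (fun u hu => by nlinarith [hu.2]), h0 hrR (fun u hu => by nlinarith [hu.1]),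
    integral_sqrt_sq_sub_sq hr]
  ring

/-- For `χ` with derivative `κ u * √(R² - u²)`, a continuous function on the line that restricts
to `1 / κ - 1` in the parameter `χ` and vanishes soon to the left of `χ (-R)`. -/
theorem exists_fibre_excess {R δ θ : ℝ} {κ χ : ℝ → ℝ} (hR : 0 < R) (hδ : 0 < δ) (hθ : 0 < θ)
    (hκ : Continuous κ) (hδκ : ∀ u, δ ≤ κ u) (hκ1 : ∀ u, κ u ≤ 1)
    (hχ : ∀ u, HasDerivAt χ (κ u * √(R ^ 2 - u ^ 2)) u) :
    ∃ B : ℝ → ℝ, Continuous B ∧ (∀ x, 0 ≤ B x) ∧ (∀ x ≤ χ (-R) - θ, B x = 0) ∧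
      (∀ u ∈ Icc (-R) R, B (χ u) = 1 / κ u - 1) ∧
      ∫ x in (χ (-R) - θ)..(χ R), B x ≤ π * R ^ 2 / 2 - (χ R - χ (-R)) + θ / δ := by
  have hpos (u : ℝ) : 0 < κ u := hδ.trans_le (hδκ u)
  have hχc : Continuous χ := continuous_iff_continuousAt.2 fun x => (hχ x).continuousAt
  have hkc : Continuous fun u => κ u * √(R ^ 2 - u ^ 2) := by fun_prop
  have hmono : StrictMonoOn χ (Icc (-R) R) := by
    refine strictMonoOn_of_deriv_pos (convex_Icc _ _) hχc.continuousOn fun u hu => ?_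
    rw [interior_Icc] at hu
    rw [(hχ u).deriv]
    exact mul_pos (hpos u) (Real.sqrt_pos.2 (by nlinarith [hu.1, hu.2]))
  have hemb : Topology.IsClosedEmbedding ((Icc (-R) R).domRestrict χ) :=
    Continuous.isClosedEmbedding (hχc.comp continuous_subtype_val)
      (injOn_iff_injective.1 hmono.injOn)
  obtain ⟨B₀, hB₀⟩ := ContinuousMap.exists_extension' hemb
    (⟨fun u => 1 / κ u - 1, (continuous_const.div (hκ.comp continuous_subtype_val)
      fun u => (hpos u.1).ne').sub continuous_const⟩ : C(Icc (-R) R, ℝ))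
  have hB₀' (u : ℝ) (hu : u ∈ Icc (-R) R) : B₀ (χ u) = 1 / κ u - 1 := congrFun hB₀ ⟨u, hu⟩
  set ramp : ℝ → ℝ := fun x => (x - (χ (-R) - θ)) / (θ * δ) with hramp
  set B : ℝ → ℝ := fun x => max 0 (min (B₀ x) (ramp x)) with hB
  have hBc : Continuous B := by
    have : Continuous B₀ := B₀.continuous
    fun_prop
  have hBχ (u : ℝ) (hu : u ∈ Icc (-R) R) : B (χ u) = 1 / κ u - 1 := by
    have h1 : χ (-R) ≤ χ u := hmono.monotoneOn ⟨le_rfl, by linarith⟩ hu hu.1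
    have h2 : 1 / δ ≤ ramp (χ u) := by
      rw [hramp, div_le_div_iff₀ hδ (by positivity)]
      nlinarith
    have h3 : 1 / κ u ≤ 1 / δ := one_div_le_one_div_of_le hδ (hδκ u)
    have h4 : 1 ≤ 1 / κ u := (one_le_div (hpos u)).2 (hκ1 u)
    simp only [hB, hB₀' u hu]
    rw [min_eq_left (by linarith), max_eq_right (by linarith)]
  refine ⟨B, hBc, fun x => le_max_left _ _, fun x hx => ?_, hBχ, ?_⟩
  · have : ramp x ≤ 0 := div_nonpos_of_nonpos_of_nonneg (by linarith) (by positivity)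
    exact max_eq_left ((min_le_right _ _).trans this)
  · have hi (a b : ℝ) := hBc.intervalIntegrable (μ := MeasureTheory.volume) a b
    rw [← intervalIntegral.integral_add_adjacent_intervals (hi _ (χ (-R))) (hi _ _)]
    have h1 : ∫ x in (χ (-R) - θ)..(χ (-R)), B x ≤ θ / δ := by
      have : ∫ x in (χ (-R) - θ)..(χ (-R)), B x ≤ ∫ x in (χ (-R) - θ)..(χ (-R)), 1 / δ := by
        refine intervalIntegral.integral_mono_on (by linarith) (hi _ _)
          intervalIntegrable_const fun x hx => max_le (by positivity) ((min_le_right _ _).trans ?_)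
        rw [hramp, div_le_div_iff₀ (by positivity) hδ]
        nlinarith [hx.2]
      refine this.trans_eq ?_
      rw [intervalIntegral.integral_const, smul_eq_mul]
      ring
    have h2 : ∫ x in (χ (-R))..(χ R), B x = π * R ^ 2 / 2 - (χ R - χ (-R)) := by
      rw [← intervalIntegral.integral_comp_mul_deriv (fun u _ => hχ u) hkc.continuousOn hBc,
        ← intervalIntegral.integral_eq_sub_of_hasDerivAt (fun u _ => hχ u)
          (hkc.intervalIntegrable _ _), ← integral_sqrt_sq_sub_sq hR,
        ← intervalIntegral.integral_sub (Continuous.intervalIntegrable (by fun_prop) _ _)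
          (hkc.intervalIntegrable _ _)]
      refine intervalIntegral.integral_congr fun u hu => ?_
      rw [uIcc_of_le (by linarith)] at hu
      have := (hpos u).ne'
      simp only [Function.comp, hBχ u hu]
      field_simp
    linarith

/-- A smooth reparametrization `N` of the line, equal to the identity near `[-1, 1]` and
with derivative `μ` away from it. -/
theorem exists_fibre_stretch {μ η : ℝ} (hμ : 1 ≤ μ) (hη : 0 < η) :
    ∃ n N : ℝ → ℝ, ContDiff ℝ (⊤ : ℕ∞) n ∧ (∀ y, HasDerivAt N (n y) y) ∧ (∀ y, 1 ≤ n y) ∧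
      (∀ y, n y ≤ μ) ∧ (∀ y, |y| ≤ 1 → n y = 1) ∧ (∀ y, 1 + η ≤ |y| → n y = μ) ∧
      ∀ y, |N y| ≤ 1 + μ * max 0 (|y| - 1) := by
  set n : ℝ → ℝ := fun y => 1 + (μ - 1) * Real.smoothTransition ((y ^ 2 - 1) / η) with hn
  have hns : ContDiff ℝ (⊤ : ℕ∞) n := contDiff_const.add (contDiff_const.mul
    (Real.smoothTransition.contDiff.comp (by fun_prop)))
  have hn1 (y : ℝ) : 1 ≤ n y := by
    have := mul_nonneg (sub_nonneg.2 hμ) (Real.smoothTransition.nonneg ((y ^ 2 - 1) / η))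
    simp only [hn]; linarith
  have hnμ (y : ℝ) : n y ≤ μ := by
    have := mul_le_mul_of_nonneg_left (Real.smoothTransition.le_one ((y ^ 2 - 1) / η))
      (sub_nonneg.2 hμ)
    simp only [hn]; linarith
  have hnin (y : ℝ) (hy : |y| ≤ 1) : n y = 1 := by
    have : (y ^ 2 - 1) / η ≤ 0 :=
      div_nonpos_of_nonpos_of_nonneg (by nlinarith [sq_abs y, abs_nonneg y]) hη.le
    simp [hn, Real.smoothTransition.zero_of_nonpos this]
  have hnout (y : ℝ) (hy : 1 + η ≤ |y|) : n y = μ := by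
    have : 1 ≤ (y ^ 2 - 1) / η := by
      rw [le_div_iff₀ hη]
      nlinarith [sq_abs y, abs_nonneg y]
    simp [hn, Real.smoothTransition.one_of_one_le this]
  have hi (a b : ℝ) := hns.continuous.intervalIntegrable (μ := MeasureTheory.volume) a b
  have hb {a b : ℝ} (hab : a ≤ b) :
      0 ≤ ∫ t in a..b, n t ∧ ∫ t in a..b, n t ≤ μ * (b - a) := by
    constructor
    · exact intervalIntegral.integral_nonneg hab fun t _ => by linarith [hn1 t]
    · have : ∫ t in a..b, n t ≤ ∫ t in a..b, μ :=
        intervalIntegral.integral_mono_on hab (hi _ _) intervalIntegrable_const fun t _ => hnμ t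
      refine this.trans_eq ?_
      rw [intervalIntegral.integral_const, smul_eq_mul, mul_comm]
  have hin {a b : ℝ} (ha : |a| ≤ 1) (hb : |b| ≤ 1) : ∫ t in a..b, n t = b - a := by
    rw [intervalIntegral.integral_congr (g := fun _ => 1)]
    · simp
    · intro t ht
      rw [abs_le] at ha hb
      have := uIcc_subset_Icc (a₂ := -1) (b₂ := (1 : ℝ)) ha hb ht
      exact hnin t (abs_le.2 this)
  refine ⟨n, fun y => ∫ t in (0 : ℝ)..y, n t, hns,
    fun y => hasDerivAt_integral_of_continuous hns.continuous 0 y, hn1, hnμ, hnin, hnout,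
    fun y => ?_⟩
  rcases le_total |y| 1 with hy | hy
  · dsimp only
    rw [hin (by simp) hy, max_eq_left (by linarith)]
    simpa using hy
  · rw [max_eq_right (by linarith)]
    rcases le_total 0 y with h0 | h0
    · rw [abs_of_nonneg h0] at hy ⊢
      have := hb hy
      dsimp only
      rw [← intervalIntegral.integral_add_adjacent_intervals (hi 0 1) (hi 1 y),
        hin (by simp) (by simp), abs_of_nonneg (by linarith)]
      linarith
    · rw [abs_of_nonpos h0] at hy ⊢
      have := hb (a := y) (b := -1) (by linarith)
      dsimp only
      rw [← intervalIntegral.integral_add_adjacent_intervals (hi 0 (-1)) (hi (-1) y),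
        hin (by simp) (by simp), intervalIntegral.integral_symm y (-1), abs_of_nonpos (by linarith)]
      linarith

/-- A symplectic embedding of the disc of radius `R` into the strip over an interval whose fibres
over `s` have length at most `2 * a s`; the concentric disc of radius `r` and the negative ray
end up to the left of `s₀`, where there is hardly more room than the area of the small disc. -/
theorem exists_profile_embedding {r R ε : ℝ} (hr : 0 < r) (hrR : r < R) (hε : 0 < ε) :
    ∃ Φ : ℝ × ℝ → ℝ × ℝ, ∃ a : ℝ → ℝ, ∃ lo hi s₀ : ℝ,
      SympEmb2 Φ {p | p.1 ^ 2 + p.2 ^ 2 < R ^ 2} ∧ ContDiff ℝ (⊤ : ℕ∞) a ∧ (∀ s, 0 < a s) ∧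
      (∀ p : ℝ × ℝ, p.1 ^ 2 + p.2 ^ 2 < R ^ 2 →
        lo < (Φ p).1 ∧ (Φ p).1 < hi ∧ |(Φ p).2| < a (Φ p).1) ∧
      (∀ p : ℝ × ℝ, p.1 ^ 2 + p.2 ^ 2 < R ^ 2 →
        (p.1 ^ 2 + p.2 ^ 2 < r ^ 2 ∨ p.1 < 0 ∧ p.2 = 0) → (Φ p).1 < s₀) ∧
      ∫ s in lo..s₀, 2 * a s ≤ π * r ^ 2 + ε ∧ ∫ s in lo..hi, 2 * a s ≤ π * R ^ 2 + ε := by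
  have hR : 0 < R := hr.trans hrR
  obtain ⟨κ, δ, hδ, hκ, hδκ, hκ1, hκlo, hκhi⟩ :=
    exists_disc_profile hr hrR (ε := ε / (8 * R)) (by positivity)
  have hκpos (u : ℝ) : 0 < κ u := hδ.trans_le (hδκ u)
  set k : ℝ → ℝ := fun u => κ u * √(R ^ 2 - u ^ 2) with hk
  have hκc := hκ.continuous
  have hkc : Continuous k := by fun_prop
  have hki (a b : ℝ) := hkc.intervalIntegrable (μ := MeasureTheory.volume) a b
  have hkpos (u : ℝ) (hu : u ∈ Ioo (-R) R) : 0 < k u :=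
    mul_pos (hκpos u) (Real.sqrt_pos.2 (by nlinarith [hu.1, hu.2]))
  have hks : ContDiffOn ℝ (⊤ : ℕ∞) k (Ioo (-R) R) := by
    refine hκ.contDiffOn.mul (ContDiffOn.sqrt (by fun_prop) fun u hu => ?_)
    have : 0 < R ^ 2 - u ^ 2 := by nlinarith [hu.1, hu.2]
    exact this.ne'
  set χ : ℝ → ℝ := fun u => ∫ t in R..u, k t with hχdef
  have hχ (u : ℝ) : HasDerivAt χ (k u) u := hasDerivAt_integral_of_continuous hkc R u
  have hχc : Continuous χ := continuous_iff_continuousAt.2 fun x => (hχ x).continuousAt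
  have hmono : StrictMonoOn χ (Icc (-R) R) := by
    refine strictMonoOn_of_deriv_pos (convex_Icc _ _) hχc.continuousOn fun u hu => ?_
    rw [interior_Icc] at hu
    rw [(hχ u).deriv]
    exact hkpos u hu
  have hχR : χ R = 0 := by simp [hχdef]
  obtain ⟨L, hL⟩ : ∃ L, L = -χ (-R) := ⟨_, rfl⟩
  have hLint : L = ∫ u in (-R)..R, k u := by
    rw [hL, hχdef, intervalIntegral.integral_symm]
  have hsq (ρ : ℝ) : IntervalIntegrable (fun u => √(ρ ^ 2 - u ^ 2)) MeasureTheory.volume (-R) R :=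
    Continuous.intervalIntegrable (by fun_prop) _ _
  have hLhi : L ≤ π * r ^ 2 / 2 + ε / 4 := by
    have h : ∫ u in (-R)..R, k u ≤ ∫ u in (-R)..R, (√(r ^ 2 - u ^ 2) + ε / (8 * R)) :=
      intervalIntegral.integral_mono_on (by linarith) (hki _ _)
        ((hsq r).add intervalIntegrable_const) fun u _ => hκhi u
    rw [intervalIntegral.integral_add (hsq r) intervalIntegrable_const,
      integral_sqrt_sq_sub_sq_of_le hr hrR.le, intervalIntegral.integral_const, smul_eq_mul] at h
    have h2 : (R - -R) * (ε / (8 * R)) = ε / 4 := by field_simp; ring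
    linarith
  have hrm : r ∈ Icc (-R) R := ⟨by linarith, hrR.le⟩
  have hRm : R ∈ Icc (-R) R := ⟨by linarith, le_rfl⟩
  have hRm' : -R ∈ Icc (-R) R := ⟨le_rfl, by linarith⟩
  have hs₀ : χ r < 0 := hχR ▸ hmono hrm hRm hrR
  have hs₀' : -L < χ r := by rw [hL, neg_neg]; exact hmono hRm' hrm (by linarith)
  have hL0 : 0 < L := by linarith
  have hθ : 0 < ε * δ / 4 := by positivity
  obtain ⟨B, hBc, hB0, hBleft, hBχ, hBint⟩ := exists_fibre_excess hR hδ hθ hκc hδκ hκ1 hχ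
  set θ := ε * δ / 4 with hθdef
  have hχmR : χ (-R) = -L := by linarith
  rw [hχR, hχmR] at hBint
  rw [hχmR] at hBleft
  have hθδ : θ / δ = ε / 4 := by rw [hθdef]; field_simp
  rw [hθδ] at hBint
  obtain ⟨μ, hμ1, hμ⟩ : ∃ μ : ℝ, 1 ≤ μ ∧ L + θ ≤ μ * (-χ r) := by
    refine ⟨max 1 ((L + θ) / (-χ r)), le_max_left _ _, ?_⟩
    rw [← div_le_iff₀ (by linarith)]
    exact le_max_right _ _
  have hμ0 : 0 < μ := by linarith
  obtain ⟨n, N, hn, hN, hn1, hnμ, hnin, hnout, hNb⟩ :=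
    exists_fibre_stretch hμ1 (η := ε / (8 * L * μ)) (by positivity)
  set η := ε / (8 * L * μ) with hη
  have hη0 : 0 < η := by positivity
  have hμη : μ * η = ε / (8 * L) := by rw [hη]; field_simp
  set A : ℝ → ℝ := fun s => 1 + μ * η + μ * B (μ * s) with hA
  have hAc : Continuous A := by fun_prop
  obtain ⟨a, ha, haA⟩ := exists_smooth_between hAc (ε := ε / (8 * L)) (by positivity)
  have hA1 (s : ℝ) : 1 + μ * η ≤ A s := by
    have := mul_nonneg hμ0.le (hB0 (μ * s))
    simp only [hA]; linarith
  have hai (x y : ℝ) : IntervalIntegrable (fun s => 2 * a s) MeasureTheory.volume x y :=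
    (ha.continuous.const_mul 2).intervalIntegrable _ _
  have hBi (x y : ℝ) := hBc.intervalIntegrable (μ := MeasureTheory.volume) x y
  have hBμi (x y : ℝ) : IntervalIntegrable (fun s => μ * B (μ * s)) MeasureTheory.volume x y :=
    Continuous.intervalIntegrable (by fun_prop) _ _
  have hea (x y : ℝ) (hxy : x ≤ y) : ∫ s in x..y, 2 * a s ≤
      2 * ((1 + ε / (4 * L)) * (y - x) + ∫ s in (μ * x)..(μ * y), B s) := by
    have h1 : ∫ s in x..y, 2 * a s ≤ ∫ s in x..y, 2 * ((1 + ε / (4 * L)) + μ * B (μ * s)) := by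
      refine intervalIntegral.integral_mono_on hxy (hai _ _)
        ((intervalIntegrable_const.add (hBμi _ _)).const_mul 2) fun s _ => ?_
      have h2 := (haA s).2
      have h3 : ε / (4 * L) = ε / (8 * L) + ε / (8 * L) := by field_simp; ring
      simp only [hA, hμη] at h2
      linarith
    refine h1.trans_eq ?_
    rw [intervalIntegral.integral_const_mul,
      intervalIntegral.integral_add intervalIntegrable_const (hBμi _ _),
      intervalIntegral.integral_const, intervalIntegral.integral_const_mul,
      intervalIntegral.mul_integral_comp_mul_left, smul_eq_mul]
    ring
  have hBzero (x y : ℝ) (hxy : x ≤ y) (hy : y ≤ -L - θ) : ∫ s in x..y, B s = 0 := by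
    rw [intervalIntegral.integral_congr (g := fun _ => 0), intervalIntegral.integral_zero]
    intro s hs
    rw [uIcc_of_le hxy] at hs
    exact hBleft s (hs.2.trans hy)
  have hεL : ε / (4 * L) * L = ε / 4 := by field_simp
  set D : Set (ℝ × ℝ) := {p | p.1 ^ 2 + p.2 ^ 2 < R ^ 2} with hD
  have hDo : IsOpen D := isOpen_lt (by fun_prop) continuous_const
  have hDI : D ⊆ Ioo (-R) R ×ˢ univ := fun p hp => by
    have h1 : p.1 ^ 2 + p.2 ^ 2 < R ^ 2 := hp
    have h2 := abs_lt_of_sq_lt_sq' (show p.1 ^ 2 < R ^ 2 by nlinarith [sq_nonneg p.2]) hR.le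
    exact ⟨h2, mem_univ _⟩
  have hE₁ : SympEmb2 (fun p => (χ p.1, (p.2 + 0) / k p.1)) (Ioo (-R) R ×ˢ univ) :=
    sympEmb2_of_fst isOpen_Ioo (fun u _ => hχ u) hks hkpos
      (hmono.injOn.mono Ioo_subset_Icc_self) contDiffOn_const
  have hE₁D : SympEmb2 (fun p => (χ p.1, (p.2 + 0) / k p.1)) D :=
    ⟨hE₁.1.mono hDI, hE₁.2.1.mono hDI, fun p hp => hE₁.2.2 p (hDI hp)⟩
  have hE₂ : SympEmb2 (fun p => (p.1 / n p.2, N p.2)) univ :=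
    sympEmb2_of_snd hN hn (fun y => by linarith [hn1 y])
      (strictMono_of_hasDerivAt_pos hN fun y => by linarith [hn1 y]).injective
  refine ⟨_, a, -L, 0, χ r, hE₂.comp hDo isOpen_univ hE₁D (mapsTo_univ _ _), ha,
    fun s => ?_, ?_, ?_, ?_, ?_⟩
  · have : 0 < μ * η := by positivity
    linarith [(haA s).1, hA1 s]
  · rintro ⟨u, v⟩ hp
    have hu : u ∈ Ioo (-R) R := (hDI hp).1
    have hu' := Ioo_subset_Icc_self hu
    simp only [Function.comp, add_zero]
    set y := v / k u with hy
    have hx0 : χ u < 0 := hχR ▸ hmono hu' hRm hu.2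
    have hxL : -L < χ u := hχmR ▸ hmono hRm' hu' hu.1
    have hny : 0 < n y := by linarith [hn1 y]
    have hyκ : |y| < 1 / κ u := by
      rw [hy, abs_div, abs_of_pos (hkpos u hu), div_lt_div_iff₀ (hkpos u hu) (hκpos u), one_mul,
        mul_comm, hk]
      refine mul_lt_mul_of_pos_left ?_ (hκpos u)
      refine Real.lt_sqrt_of_sq_lt ?_
      rw [sq_abs]; simp only at hp; linarith
    refine ⟨?_, div_neg_of_neg_of_pos hx0 hny, ?_⟩
    · rw [lt_div_iff₀ hny]; nlinarith [hn1 y]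
    · refine lt_of_le_of_lt ?_ (haA _).1
      refine (hNb y).trans ?_
      rcases le_total |y| (1 + η) with h | h
      · refine le_trans ?_ (hA1 _)
        have : max 0 (|y| - 1) ≤ η := max_le hη0.le (by linarith)
        have := mul_le_mul_of_nonneg_left this hμ0.le
        linarith
      · have h1 : μ * (χ u / μ) = χ u := by field_simp
        rw [max_eq_right (by linarith), hnout y h, hA]
        simp only [h1, hBχ u hu']
        have : μ * (|y| - 1) ≤ μ * (1 / κ u - 1) :=
          mul_le_mul_of_nonneg_left (by linarith) hμ0.le
        have : 0 < μ * η := by positivity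
        linarith
  · rintro ⟨u, v⟩ hp hc
    have hu : u ∈ Ioo (-R) R := (hDI hp).1
    have hu' := Ioo_subset_Icc_self hu
    simp only at hp hc
    simp only [Function.comp, add_zero]
    have key : u < r ∧ |v / k u| ≤ 1 := by
      rcases hc with hc | ⟨hc, rfl⟩
      · refine ⟨(abs_lt_of_sq_lt_sq' (show u ^ 2 < r ^ 2 by nlinarith [sq_nonneg v]) hr.le).2, ?_⟩
        rw [abs_div, abs_of_pos (hkpos u hu), div_le_one (hkpos u hu)]
        refine le_trans (Real.le_sqrt_of_sq_le ?_) (hκlo u)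
        rw [sq_abs]; linarith
      · exact ⟨by linarith, by simp⟩
    rw [hnin _ key.2, div_one]
    exact hmono hu' hrm key.1
  · refine (hea _ _ hs₀'.le).trans ?_
    rw [hBzero _ _ (by nlinarith) (by linarith)]
    have h1 : (1 + ε / (4 * L)) * (χ r - -L) ≤ (1 + ε / (4 * L)) * L :=
      mul_le_mul_of_nonneg_left (by linarith) (by positivity)
    linarith
  · refine (hea _ _ (by linarith)).trans ?_
    have hmL : μ * -L ≤ -L - θ := by nlinarith
    rw [mul_zero, ← intervalIntegral.integral_add_adjacent_intervals (hBi _ (-L - θ)) (hBi _ _),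
      hBzero _ _ hmL le_rfl]
    linarith

/-- A smooth height function subordinate to an `ε`-neighbourhood of
`[0,1] × [0,ℓ] ∪ [1,2] × {0} ∪ [2,3] × [0,c]`. -/
theorem exists_height_function {ℓ c ε : ℝ} (hℓ : 0 < ℓ) (hc : 0 < c) (hε : 0 < ε)
    (hε2 : ε < 1 / 2) :
    ∃ h : ℝ → ℝ, ContDiff ℝ (⊤ : ℕ∞) h ∧ (∀ x, ε / 2 ≤ h x) ∧ (∀ x < 1 + ε, h x < ℓ + ε) ∧
      (∀ x ∈ Icc (1 + ε) (2 - ε), h x < ε) ∧ (∀ x > 2 - ε, h x < c + ε) ∧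
      ℓ + ε / 2 ≤ ∫ x in (0 : ℝ)..1, h x ∧ ℓ + c + ε ≤ ∫ x in (0 : ℝ)..3, h x := by
  set σ := Real.smoothTransition
  have hσ0 : ∀ x, 0 ≤ σ x := Real.smoothTransition.nonneg
  have hσ1 : ∀ x, σ x ≤ 1 := Real.smoothTransition.le_one
  have hσz {x : ℝ} : x ≤ 0 → σ x = 0 := Real.smoothTransition.zero_of_nonpos
  have hσo {x : ℝ} : 1 ≤ x → σ x = 1 := Real.smoothTransition.one_of_one_le
  set h : ℝ → ℝ := fun x => ε / 2 + ℓ * σ ((1 + ε - x) / ε) + c * σ ((x - (2 - ε)) / ε) with hh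
  have hs : ContDiff ℝ (⊤ : ℕ∞) h :=
    (contDiff_const.add (contDiff_const.mul (Real.smoothTransition.contDiff.comp (by fun_prop)))).add
      (contDiff_const.mul (Real.smoothTransition.contDiff.comp (by fun_prop)))
  have hl (x : ℝ) := mul_nonneg hℓ.le (hσ0 ((1 + ε - x) / ε))
  have hr (x : ℝ) := mul_nonneg hc.le (hσ0 ((x - (2 - ε)) / ε))
  have hl1 (x : ℝ) := mul_le_mul_of_nonneg_left (hσ1 ((1 + ε - x) / ε)) hℓ.le
  have hr1 (x : ℝ) := mul_le_mul_of_nonneg_left (hσ1 ((x - (2 - ε)) / ε)) hc.le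
  have hlz (x : ℝ) (hx : 1 + ε ≤ x) : σ ((1 + ε - x) / ε) = 0 :=
    hσz (div_nonpos_of_nonpos_of_nonneg (by linarith) hε.le)
  have hrz (x : ℝ) (hx : x ≤ 2 - ε) : σ ((x - (2 - ε)) / ε) = 0 :=
    hσz (div_nonpos_of_nonpos_of_nonneg (by linarith) hε.le)
  have hi (a b : ℝ) := hs.continuous.intervalIntegrable (μ := MeasureTheory.volume) a b
  have hpos (x : ℝ) : ε / 2 ≤ h x := by simp only [hh]; linarith [hl x, hr x]
  have hlow {a m : ℝ} (hm : ∀ x ∈ Icc a (a + 1), m ≤ h x) : m ≤ ∫ x in a..(a + 1), h x := by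
    have := intervalIntegral.integral_mono_on (by linarith) intervalIntegrable_const (hi a (a + 1)) hm
    simpa using this
  have h01 : ℓ + ε / 2 ≤ ∫ x in (0 : ℝ)..1, h x := by
    have := hlow (a := 0) (m := ℓ + ε / 2) fun x hx => by
      have : σ ((1 + ε - x) / ε) = 1 := hσo ((one_le_div hε).2 (by linarith [hx.2]))
      simp only [hh, this]; linarith [hr x]
    simpa using this
  have h23 : c + ε / 2 ≤ ∫ x in (2 : ℝ)..3, h x := by
    have := hlow (a := 2) (m := c + ε / 2) fun x hx => by
      have : σ ((x - (2 - ε)) / ε) = 1 := hσo ((one_le_div hε).2 (by linarith [hx.1]))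
      simp only [hh, this]; linarith [hl x]
    norm_num at this ⊢
    exact this
  have h12 : 0 ≤ ∫ x in (1 : ℝ)..2, h x :=
    intervalIntegral.integral_nonneg (by norm_num) fun x _ => by linarith [hpos x]
  refine ⟨h, hs, hpos, fun x hx => ?_, fun x hx => ?_, fun x hx => ?_, h01, ?_⟩
  · simp only [hh, hrz x (by linarith)]; linarith [hl1 x]
  · simp only [hh, hlz x hx.1, hrz x hx.2]; linarith
  · simp only [hh, hlz x (by linarith)]; linarith [hr1 x]
  · rw [← intervalIntegral.integral_add_adjacent_intervals (hi 0 1) (hi 1 3),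
      ← intervalIntegral.integral_add_adjacent_intervals (hi 1 2) (hi 2 3)]
    linarith

/-- **Two-dimensional embedding lemma** used in the proof of Lemma 2.1: for
`Y = P₁ ∪ L ∪ P₂` with `P₁ = [0,1] × [0,C−c]`, `L = [1,2] × {0}`, `P₂ = [2,3] × [0,c]`,
every neighbourhood `U` of `Y` and every neighbourhood `U₁` of `P₁` admit an
area-preserving embedding `g : B²(C) → U` mapping some open neighbourhood (within
`B²(C)`) of `B²(C−c) ∪ ({(u,0) : u < 0} ∩ B²(C))` into `U₁`. -/
theorem disc_embedding_lemma (c C : ℝ) (hc : 0 < c) (hcC : c < C)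
    (U U₁ : Set (ℝ × ℝ)) (hU : IsOpen U) (hU₁ : IsOpen U₁)
    (hYU : ((Icc (0:ℝ) 1 ×ˢ Icc (0:ℝ) (C - c)) ∪ (Icc (1:ℝ) 2 ×ˢ ({0} : Set ℝ)) ∪
      (Icc (2:ℝ) 3 ×ˢ Icc (0:ℝ) c)) ⊆ U)
    (hPU₁ : (Icc (0:ℝ) 1 ×ˢ Icc (0:ℝ) (C - c)) ⊆ U₁) :
    ∃ g : ℝ × ℝ → ℝ × ℝ, SympEmb2 g (disc C) ∧ g '' disc C ⊆ U ∧
      ∃ W : Set (ℝ × ℝ), IsOpen W ∧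
        (disc (C - c) ∪ ({p : ℝ × ℝ | p.1 < 0 ∧ p.2 = 0} ∩ disc C)) ⊆ W ∧
        g '' (W ∩ disc C) ⊆ U₁ := by
  have hℓ : 0 < C - c := sub_pos.2 hcC
  have hC : 0 < C := hc.trans hcC
  have hP₁ : IsCompact (Icc (0:ℝ) 1 ×ˢ Icc (0:ℝ) (C - c)) := isCompact_Icc.prod isCompact_Icc
  obtain ⟨ε₁, hε₁, hthU⟩ := ((hP₁.union (isCompact_Icc.prod isCompact_singleton)).union
    (isCompact_Icc.prod isCompact_Icc)).exists_thickening_subset_open hU hYU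
  obtain ⟨ε₂, hε₂, hthU₁⟩ := hP₁.exists_thickening_subset_open hU₁ hPU₁
  obtain ⟨ε, hε, hεle₁, hεle₂, hε3⟩ : ∃ ε > 0, ε ≤ ε₁ ∧ ε ≤ ε₂ ∧ ε < 1 / 2 :=
    ⟨min (min ε₁ ε₂) (1 / 3), by positivity, (min_le_left _ _).trans (min_le_left _ _),
      (min_le_left _ _).trans (min_le_right _ _), (min_le_right _ _).trans_lt (by norm_num)⟩
  obtain ⟨h, hh, hhpos, hh₁, hh₂, hh₃, hint₁, hint₃⟩ := exists_height_function hℓ hc hε hε3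
  obtain ⟨ψ, hψ, hψmono, hψd, hψinv⟩ := exists_smooth_inverse_primitive hh (half_pos hε) hhpos
  have hπ := Real.pi_pos
  obtain ⟨Φ, a, lo, hi, s₀, hΦ, ha, hapos, hΦa, hΦs, hia₁, hia₃⟩ :=
    exists_profile_embedding (r := √((C - c) / π)) (R := √(C / π)) (ε := ε / 4)
      (Real.sqrt_pos.2 (by positivity))
      (Real.sqrt_lt_sqrt (by positivity) (div_lt_div_of_pos_right (by linarith) hπ))
      (by positivity)
  rw [Real.sq_sqrt (by positivity)] at hΦ hia₁ hia₃ hΦa hΦs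
  rw [Real.sq_sqrt (by positivity)] at hΦs
  rw [mul_div_cancel₀ _ hπ.ne'] at hia₁ hia₃
  have h2a : Continuous fun s => 2 * a s := ha.continuous.const_mul 2
  have h2ai (x y : ℝ) := h2a.intervalIntegrable (μ := MeasureTheory.volume) x y
  set I : ℝ → ℝ := fun s => ∫ t in lo..s, 2 * a t with hI
  have hId (s : ℝ) : HasDerivAt I (2 * a s) s := hasDerivAt_integral_of_continuous h2a lo s
  have hImono : StrictMono I := strictMono_of_hasDerivAt_pos hId fun s => by linarith [hapos s]
  have hIlo : I lo = 0 := by simp [hI]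
  set φ : ℝ → ℝ := fun s => ψ (I s) with hφ
  have hφd (s : ℝ) : HasDerivAt φ ((h (φ s))⁻¹ * (2 * a s)) s := (hψd _).comp s (hId s)
  have hφmono : StrictMono φ := hψmono.comp hImono
  have hhp (x : ℝ) : 0 < h x := by linarith [hhpos x]
  have hIs : ContDiff ℝ (⊤ : ℕ∞) I := contDiffOn_univ.1 (contDiffOn_of_hasDerivAt isOpen_univ
    (fun x _ => hId x) (contDiff_const.mul ha).contDiffOn)
  have hφ's : ContDiff ℝ (⊤ : ℕ∞) fun s => (h (φ s))⁻¹ * (2 * a s) :=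
    ((hh.comp (hψ.comp hIs)).inv fun s => (hhp _).ne').mul (contDiff_const.mul ha)
  have hG : SympEmb2 (fun p => (φ p.1, (p.2 + a p.1) / ((h (φ p.1))⁻¹ * (2 * a p.1)))) univ := by
    rw [← univ_prod_univ]
    exact sympEmb2_of_fst isOpen_univ (fun s _ => hφd s) hφ's.contDiffOn
      (fun s _ => mul_pos (inv_pos.2 (hhp _)) (by linarith [hapos s])) hφmono.injective.injOn
      ha.contDiffOn
  have hDo : IsOpen (disc C) := isOpen_lt (by fun_prop) continuous_const
  set g := (fun p : ℝ × ℝ => (φ p.1, (p.2 + a p.1) / ((h (φ p.1))⁻¹ * (2 * a p.1)))) ∘ Φ with hg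
  have hgY (p : ℝ × ℝ) (hp : p ∈ disc C) : 0 < (g p).2 ∧ (g p).2 < h (g p).1 := by
    have h1 := abs_lt.1 (hΦa p hp).2.2
    have h2 := hapos (Φ p).1
    have h3 := hhp (φ (Φ p).1)
    have h4 : (g p).2 = h (φ (Φ p).1) * (((Φ p).2 + a (Φ p).1) / (2 * a (Φ p).1)) := by
      simp only [hg, Function.comp]; field_simp
    have h5 : (g p).1 = φ (Φ p).1 := rfl
    rw [h4, h5]
    refine ⟨mul_pos h3 (div_pos (by linarith) (by linarith)), ?_⟩
    refine mul_lt_of_lt_one_right h3 ((div_lt_one (by linarith)).2 (by linarith))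
  have hgX (p : ℝ × ℝ) (hp : p ∈ disc C) : 0 < (g p).1 ∧ (g p).1 < 3 := by
    have h1 : I lo < I (Φ p).1 := hImono (hΦa p hp).1
    have h2 : I (Φ p).1 < I hi := hImono (hΦa p hp).2.1
    constructor
    · calc (0 : ℝ) = ψ (∫ t in (0 : ℝ)..0, h t) := (hψinv 0).symm
        _ < ψ (I (Φ p).1) := hψmono (by simpa [hIlo] using h1)
    · calc ψ (I (Φ p).1) < ψ (∫ t in (0 : ℝ)..3, h t) := hψmono (by linarith)
        _ = 3 := hψinv 3
  have hnear {q : ℝ × ℝ} {x y : ℝ} (hx : |q.1 - x| < ε) (hy : |q.2 - y| < ε) :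
      dist q (x, y) < ε := by
    rw [Prod.dist_eq, Real.dist_eq, Real.dist_eq]; exact max_lt hx hy
  have hnearP₁ (p : ℝ × ℝ) (hp : p ∈ disc C) (hlt : (g p).1 < 1 + ε) :
      ∃ q ∈ Icc (0:ℝ) 1 ×ˢ Icc (0:ℝ) (C - c), dist (g p) q < ε := by
    have hX := hgX p hp
    have hY := hgY p hp
    have hY' := hh₁ _ hlt
    refine ⟨(min (g p).1 1, min (g p).2 (C - c)), ⟨⟨le_min hX.1.le zero_le_one, min_le_right _ _⟩,
      ⟨le_min hY.1.le hℓ.le, min_le_right _ _⟩⟩, hnear (abs_lt.2 ?_) (abs_lt.2 ?_)⟩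
    · rcases min_cases (g p).1 1 with ⟨he, _⟩ | ⟨he, _⟩ <;> rw [he] <;> constructor <;> linarith
    · rcases min_cases (g p).2 (C - c) with ⟨he, _⟩ | ⟨he, _⟩ <;> rw [he] <;> constructor <;> linarith
  refine ⟨g, hG.comp hDo isOpen_univ hΦ (mapsTo_univ _ _), ?_, ?_⟩
  · rintro _ ⟨p, hp, rfl⟩
    apply hthU
    rw [Metric.mem_thickening_iff]
    have hX := hgX p hp
    have hY := hgY p hp
    rcases lt_or_ge (g p).1 (1 + ε) with h1 | h1
    · obtain ⟨q, hq, hd⟩ := hnearP₁ p hp h1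
      exact ⟨q, Or.inl (Or.inl hq), hd.trans_le hεle₁⟩
    rcases le_or_gt (g p).1 (2 - ε) with h2 | h2
    · have hY' := hh₂ _ ⟨h1, h2⟩
      refine ⟨((g p).1, 0), Or.inl (Or.inr ⟨⟨by simp only; linarith, by simp only; linarith⟩, rfl⟩),
        (hnear (by simpa using hε) (abs_lt.2 ?_)).trans_le hεle₁⟩
      constructor <;> linarith
    · have hY' := hh₃ _ h2
      refine ⟨(max (g p).1 2, min (g p).2 c), Or.inr ⟨⟨le_max_right _ _, max_le hX.2.le
        (by norm_num)⟩, ⟨le_min hY.1.le hc.le, min_le_right _ _⟩⟩,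
        (hnear (abs_lt.2 ?_) (abs_lt.2 ?_)).trans_le hεle₁⟩
      · rcases max_cases (g p).1 2 with ⟨he, _⟩ | ⟨he, _⟩ <;> rw [he] <;> constructor <;> linarith
      · rcases min_cases (g p).2 c with ⟨he, _⟩ | ⟨he, _⟩ <;> rw [he] <;> constructor <;> linarith
  · refine ⟨disc C ∩ (fun p => (Φ p).1) ⁻¹' Iio s₀,
      (hΦ.1.continuousOn.fst).isOpen_inter_preimage hDo isOpen_Iio, ?_, ?_⟩
    · rintro p (hp | ⟨hp, hpC⟩)
      · have hpC : p ∈ disc C :=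
          lt_trans hp (div_lt_div_of_pos_right (by linarith) hπ)
        exact ⟨hpC, hΦs p hpC (Or.inl hp)⟩
      · exact ⟨hpC, hΦs p hpC (Or.inr hp)⟩
    · rintro _ ⟨p, ⟨⟨hp, hs⟩, -⟩, rfl⟩
      apply hthU₁
      rw [Metric.mem_thickening_iff]
      have h1 : I (Φ p).1 < I s₀ := hImono hs
      have h2 : (g p).1 < 1 := by
        calc ψ (I (Φ p).1) < ψ (∫ t in (0 : ℝ)..1, h t) := hψmono (by linarith)
          _ = 1 := hψinv 1
      obtain ⟨q, hq, hd⟩ := hnearP₁ p hp (by linarith)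
      exact ⟨q, hq, hd.trans_le hεle₂⟩
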